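/- Fix ν, r ∈ ℕ with r ≥ 2, and suppose that there exists a (r−1)ν-Ryser-stable sequence relative to M_{r,ν+1} having length ℓ and ending with the single-edge hypergraph E_r. Let (V, d_1, …, d_r) be a family of metrics on a common finite vertex set such that every subset of V of size ν + 1 contains two distinct vertices u, v with d_i(u,v) ≤ 1 for some i. Then V can be covered by (r−1)ν balls of radius 9^((4r)^(ℓ+3)), each a ball in one of the metrics d_1, …, d_r. -/

import Mathlib

/-!
Statement 10: fix `ν, r ∈ ℕ` with `r ≥ 2` and suppose there exists a
`(r−1)ν`-Ryser-stable sequence relative to `M_{r,ν+1}` of length `ℓ` ending with the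
single-edge hypergraph `E_r`. Let `(V, d_1, …, d_r)` be a family of metrics on a common
finite vertex set such that every `(ν+1)`-subset of `V` contains distinct `u, v` with
`d_i(u,v) ≤ 1` for some `i`. Then `V` can be covered by `(r−1)ν` balls of radius
`9^((4r)^(ℓ+3))`, each a ball in one of the metrics `d_1, …, d_r`.

`r`-uniform, `r`-partite hypergraphs are modelled (up to isomorphism) as finite sets of
edges, each edge being a function `Fin r → ℕ` picking one vertex in each part; the
vertex in part `i` of the edge `e` is the pair `(i, e i)`.
-/

abbrev PHyp (r : ℕ) := Finset (Fin r → ℕ)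

/-- `C` is a vertex cover of `H`. -/
def IsCover {r : ℕ} (H : PHyp r) (C : Finset (Fin r × ℕ)) : Prop :=
  ∀ e ∈ H, ∃ i : Fin r, (i, e i) ∈ C

/-- `H'` contains an isomorphic copy of `H`. -/
def ContainsCopy {r : ℕ} (H' H : PHyp r) : Prop :=
  ∃ θ : Fin r → ℕ → ℕ,
    (∀ i, Set.InjOn (θ i) {v | ∃ e ∈ H, e i = v}) ∧
    ∀ e ∈ H, (fun i => θ i (e i)) ∈ H'

/-- `H` is `c`-Ryser-stable relative to the list `Hs`. -/
def RyserStable {r : ℕ} (c : ℕ) (H : PHyp r) (Hs : List (PHyp r)) : Prop :=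
  ∃ C : Finset (Fin r × ℕ), IsCover H C ∧ C.card ≤ c ∧
    ∀ H' : PHyp r, H ⊆ H' → (IsCover H' C ∨ ∃ K ∈ Hs, ContainsCopy H' K)

/-- `Hs` is a `c`-Ryser-stable sequence relative to `Rs`. -/
def RyserStableSeq {r : ℕ} (c : ℕ) (Hs Rs : List (PHyp r)) : Prop :=
  ∀ i : Fin Hs.length, RyserStable c (Hs.get i) (Hs.take i.val ++ Rs)

/-- `M_{r,ν}`, the `r`-uniform matching with `ν` pairwise disjoint edges. -/
def matchingHyp (r ν : ℕ) : PHyp r :=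
  (Finset.range ν).image fun j => fun _ : Fin r => j

/-- `d` is a metric on `V`. -/
structure IsMetricFun {V : Type} (d : V → V → ℝ) : Prop where
  eq_zero_iff : ∀ x y, d x y = 0 ↔ x = y
  symm : ∀ x y, d x y = d y x
  triangle : ∀ x y z, d x y ≤ d x z + d z y

/-- `H` is realised in `V` at scale `(a, b)`: its edges can be mapped to points of `V` so that two
edges sharing their `i`-th vertex are `d i`-close (at most `a`) and all others are `d i`-far
(more than `b`). -/
def Realizes {r : ℕ} {V : Type} (d : Fin r → V → V → ℝ) (H : PHyp r) (a b : ℝ) : Prop :=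
  ∃ φ : (Fin r → ℕ) → V, ∀ e ∈ H, ∀ f ∈ H, ∀ i,
    (e i = f i → d i (φ e) (φ f) ≤ a) ∧ (e i ≠ f i → b < d i (φ e) (φ f))

theorem Realizes.of_containsCopy {r : ℕ} {V : Type} {d : Fin r → V → V → ℝ} {H H' : PHyp r}
    {a b : ℝ} (h : Realizes d H' a b) (hc : ContainsCopy H' H) : Realizes d H a b := by
  obtain ⟨φ, hφ⟩ := h
  obtain ⟨θ, hinj, hθ⟩ := hc
  refine ⟨fun e => φ fun i => θ i (e i), fun e he f hf i => ⟨fun hef => ?_, fun hef => ?_⟩⟩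
  · exact (hφ _ (hθ e he) _ (hθ f hf) i).1 (congrArg (θ i) hef)
  · exact (hφ _ (hθ e he) _ (hθ f hf) i).2
      fun h => hef (hinj i ⟨e, he, rfl⟩ ⟨f, hf, rfl⟩ h)

/-- A chain of `r + 2` increasing predicates on `Fin r` must stabilise at some step. -/
theorem exists_step_stable {r : ℕ} (P : ℕ → Fin r → Prop) (hP : ∀ j i, P j i → P (j + 1) i) :
    ∃ j ≤ r, ∀ i, P (j + 1) i → P j i := by
  classical
  by_contra! hcon
  have key : ∀ j ≤ r + 1, j ≤ (Finset.univ.filter (P j)).card := by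
    intro j
    induction j with
    | zero => simp
    | succ j ih =>
      intro hj
      obtain ⟨i, hi, hi'⟩ := hcon j (by omega)
      have hlt : (Finset.univ.filter (P j)).card < (Finset.univ.filter (P (j + 1))).card := by
        refine Finset.card_lt_card ((Finset.ssubset_iff_of_subset ?_).2 ⟨i, ?_, ?_⟩)
        · intro k
          simpa using hP j k
        · simpa using hi
        · simpa using hi'
      have := ih (by omega)
      omega
  have h1 := key (r + 1) le_rfl
  have h2 := Finset.card_le_univ (Finset.univ.filter (P (r + 1)))
  rw [Fintype.card_fin] at h2
  omega

/-- Given a realised hypergraph `H` with cover `C`, either the balls centred at realisations of the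
vertices in `C` cover `V`, or `H` can be extended, still realised with a smaller gap between
scales, so that `C` is not a cover any more. -/
theorem Realizes.cover_or_extend {r : ℕ} {V : Type} [Nonempty V] {d : Fin r → V → V → ℝ}
    (hd : ∀ i, IsMetricFun (d i)) {H : PHyp r} {C : Finset (Fin r × ℕ)} (hC : IsCover H C)
    {p q D : ℕ} (hpq : p + (r + 1) * D + 1 ≤ q) (h : Realizes d H (9 ^ p) (9 ^ q)) :
    (∃ ctr : Fin r × ℕ → V, ∀ x, ∃ v ∈ C, d v.1 (ctr v) x ≤ 9 ^ q) ∨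
    ∃ H' : PHyp r, H ⊆ H' ∧ ¬ IsCover H' C ∧
      ∃ j ≤ r, Realizes d H' (9 ^ (p + j * D + 1)) (9 ^ (p + (j + 1) * D)) := by
  classical
  obtain ⟨φ, hφ⟩ := h
  have hsel : ∀ v : Fin r × ℕ, ∃ c : V, (∃ e ∈ H, e v.1 = v.2) → ∃ e ∈ H, e v.1 = v.2 ∧ φ e = c := by
    intro v
    by_cases hv : ∃ e ∈ H, e v.1 = v.2
    · obtain ⟨e, he, hev⟩ := hv
      exact ⟨φ e, fun _ => ⟨e, he, hev, rfl⟩⟩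
    · exact ⟨Classical.arbitrary V, fun h => absurd h hv⟩
  choose ctr hctr using hsel
  by_cases hcov : ∀ x, ∃ v ∈ C, d v.1 (ctr v) x ≤ 9 ^ q
  · exact Or.inl ⟨ctr, hcov⟩
  right
  push Not at hcov
  obtain ⟨x, hx⟩ := hcov
  have mono : ∀ {m n : ℕ}, m ≤ n → (9 : ℝ) ^ m ≤ 9 ^ n :=
    fun h => pow_le_pow_right₀ (by norm_num) h
  obtain ⟨j, hj, hstab⟩ := exists_step_stable
    (fun j i => ∃ e ∈ H, d i x (φ e) ≤ 9 ^ (p + j * D)) (by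
      rintro j i ⟨e, he, hle⟩
      exact ⟨e, he, hle.trans (mono (by nlinarith))⟩)
  have hjq : p + (j + 1) * D + 1 ≤ q := by nlinarith
  have hjj : p + j * D ≤ p + (j + 1) * D := by nlinarith
  have hpj : (9 : ℝ) ^ p ≤ 9 ^ (p + j * D) := mono (by omega)
  have hjT : (9 : ℝ) ^ (p + j * D) ≤ 9 ^ (p + (j + 1) * D) := mono hjj
  have hTq : 9 * (9 : ℝ) ^ (p + (j + 1) * D) ≤ 9 ^ q := by
    rw [← pow_succ']
    exact mono hjq
  have hpos : (0 : ℝ) < 9 ^ (p + j * D) := by positivity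
  have hnext : (9 : ℝ) ^ (p + j * D + 1) = 9 * 9 ^ (p + j * D) := pow_succ' _ _
  obtain ⟨N, hN⟩ : ∃ N : ℕ, (∀ e ∈ H, ∀ i, e i < N) ∧ ∀ v ∈ C, v.2 < N := by
    refine ⟨(∑ e ∈ H, ∑ i, e i) + (∑ v ∈ C, v.2) + 1, fun e he i => ?_, fun v hv => ?_⟩
    · have h1 := Finset.single_le_sum (f := fun i => e i) (fun _ _ => Nat.zero_le _)
        (Finset.mem_univ i)
      have h2 := Finset.single_le_sum (f := fun e : Fin r → ℕ => ∑ i, e i)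
        (fun _ _ => Nat.zero_le _) he
      omega
    · have h1 := Finset.single_le_sum (f := fun v : Fin r × ℕ => v.2)
        (fun _ _ => Nat.zero_le _) hv
      omega
  have hg : ∀ i, ∃ n : ℕ, (∃ e ∈ H, e i = n ∧ d i x (φ e) ≤ 9 ^ (p + j * D)) ∨
      (n = N ∧ ∀ e ∈ H, 9 ^ (p + (j + 1) * D) < d i x (φ e)) := by
    intro i
    by_cases hi : ∃ e ∈ H, d i x (φ e) ≤ 9 ^ (p + j * D)
    · obtain ⟨e, he, hle⟩ := hi
      exact ⟨e i, Or.inl ⟨e, he, rfl, hle⟩⟩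
    · refine ⟨N, Or.inr ⟨rfl, fun e he => ?_⟩⟩
      by_contra hle
      exact hi (hstab i ⟨e, he, not_lt.1 hle⟩)
  choose g hg using hg
  have hclose : ∀ i, ∀ f ∈ H, g i = f i → d i x (φ f) ≤ 9 ^ (p + j * D + 1) := by
    intro i f hf hgf
    rcases hg i with ⟨e, he, hei, hle⟩ | ⟨hn, -⟩
    · have h1 := (hφ e he f hf i).1 (hei.trans hgf)
      have h2 := (hd i).triangle x (φ f) (φ e)
      linarith
    · have := hN.1 f hf i
      omega
  have hfar : ∀ i, ∀ f ∈ H, g i ≠ f i → 9 ^ (p + (j + 1) * D) < d i x (φ f) := by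
    intro i f hf hgf
    rcases hg i with ⟨e, he, hei, hle⟩ | ⟨-, hn⟩
    · have h1 := (hφ e he f hf i).2 (fun h => hgf (hei.symm.trans h))
      have h2 := (hd i).triangle (φ e) (φ f) x
      rw [(hd i).symm (φ e) x] at h2
      linarith
    · exact hn f hf
  have hgC : ¬ ∃ i, (i, g i) ∈ C := by
    rintro ⟨i, hi⟩
    rcases hg i with ⟨e, he, hei, hle⟩ | ⟨hn, -⟩
    · obtain ⟨f, hf, hfi, hfc⟩ := hctr (i, g i) ⟨e, he, hei⟩
      have h1 := hx _ hi
      have h2 := hclose i f hf hfi.symm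
      rw [← hfc, (hd i).symm] at h1
      linarith
    · have := hN.2 _ hi
      simp only at this
      omega
  have hgH : g ∉ H := fun h => hgC (hC g h)
  refine ⟨insert g H, Finset.subset_insert _ _, fun h => hgC (h g (Finset.mem_insert_self _ _)),
    j, hj, Function.update φ g x, ?_⟩
  have hne : ∀ e ∈ H, Function.update φ g x e = φ e := fun e he =>
    Function.update_of_ne (fun h : e = g => hgH (h ▸ he)) _ _
  intro e he f hf i
  rcases Finset.mem_insert.1 he with heg | he' <;> rcases Finset.mem_insert.1 hf with hfg | hf'
  · rw [heg, hfg, ((hd i).eq_zero_iff _ _).2 rfl]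
    exact ⟨fun _ => by positivity, fun h => absurd rfl h⟩
  · rw [heg, Function.update_self, hne f hf']
    exact ⟨hclose i f hf', hfar i f hf'⟩
  · rw [hfg, Function.update_self, hne e he', (hd i).symm]
    exact ⟨fun h => hclose i e he' h.symm, fun h => hfar i e he' (Ne.symm h)⟩
  · rw [hne e he', hne f hf']
    refine ⟨fun h => ?_, fun h => ?_⟩
    · have := (hφ e he' f hf' i).1 h
      linarith
    · have := (hφ e he' f hf' i).2 h
      linarith

/-- A realised matching with separation at least `1` gives a set of pairwise far points. -/
theorem not_realizes_matchingHyp {r ν : ℕ} (hr : 0 < r) {V : Type} {d : Fin r → V → V → ℝ}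
    (hd : ∀ i, IsMetricFun (d i))
    (hV : ∀ S : Finset V, S.card = ν + 1 → ∃ u ∈ S, ∃ v ∈ S, u ≠ v ∧ ∃ i, d i u v ≤ 1)
    {a b : ℝ} (hb : 1 ≤ b) : ¬ Realizes d (matchingHyp r (ν + 1)) a b := by
  classical
  rintro ⟨φ, hφ⟩
  have hmem : ∀ j < ν + 1, (fun _ : Fin r => j) ∈ matchingHyp r (ν + 1) := fun j hj =>
    Finset.mem_image.2 ⟨j, Finset.mem_range.2 hj, rfl⟩
  have hfar : ∀ j < ν + 1, ∀ k < ν + 1, j ≠ k → ∀ i : Fin r,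
      1 < d i (φ fun _ => j) (φ fun _ => k) := fun j hj k hk hjk i =>
    hb.trans_lt ((hφ _ (hmem j hj) _ (hmem k hk) i).2 hjk)
  have hcard : ((Finset.range (ν + 1)).image fun j => φ fun _ => j).card = ν + 1 := by
    rw [Finset.card_image_of_injOn, Finset.card_range]
    intro j hj k hk hjk
    by_contra hne
    have h1 := hfar j (by simpa using hj) k (by simpa using hk) hne ⟨0, hr⟩
    rw [((hd _).eq_zero_iff _ _).2 hjk] at h1
    linarith
  obtain ⟨u, hu, v, hv, huv, i, hi⟩ := hV _ hcard
  obtain ⟨j, hj, rfl⟩ := Finset.mem_image.1 hu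
  obtain ⟨k, hk, rfl⟩ := Finset.mem_image.1 hv
  have h1 := hfar j (Finset.mem_range.1 hj) k (Finset.mem_range.1 hk)
    (fun h => huv (by rw [h])) i
  linarith

/-- If the `k`-th member of a stable sequence is realised with a large enough gap between its
scales, then `V` is covered by few balls. -/
theorem RyserStableSeq.exists_cover {r ν c : ℕ} (hr : 2 ≤ r) {Hs : List (PHyp r)}
    (hseq : RyserStableSeq c Hs [matchingHyp r (ν + 1)])
    {V : Type} [Nonempty V] {d : Fin r → V → V → ℝ} (hd : ∀ i, IsMetricFun (d i))
    (hV : ∀ S : Finset V, S.card = ν + 1 → ∃ u ∈ S, ∃ v ∈ S, u ≠ v ∧ ∃ i, d i u v ≤ 1)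
    (k : ℕ) (hk : k < Hs.length) (p q : ℕ) (hpq : p + (4 * r) ^ (k + 1) ≤ q)
    (h : Realizes d Hs[k] (9 ^ p) (9 ^ q)) :
    ∃ C : Finset (Fin r × ℕ), C.card ≤ c ∧
      ∃ ctr : Fin r × ℕ → V, ∀ x, ∃ v ∈ C, d v.1 (ctr v) x ≤ 9 ^ q := by
  induction k using Nat.strong_induction_on generalizing p q with
  | _ k ih =>
    obtain ⟨C, hC, hcard, hstab⟩ := hseq ⟨k, hk⟩
    have hone : 1 ≤ (4 * r) ^ k := Nat.one_le_pow _ _ (by omega)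
    have hgap : p + (r + 1) * ((4 * r) ^ k + 1) + 1 ≤ q := by
      rw [pow_succ] at hpq
      nlinarith [Nat.mul_le_mul hone hr, Nat.mul_le_mul_right r hone]
    rcases Realizes.cover_or_extend hd hC hgap h with hcov | ⟨H', hsub, hncov, j, hj, hreal⟩
    · exact ⟨C, hcard, hcov⟩
    obtain ⟨K, hK, hcopy⟩ := (hstab H' hsub).resolve_left hncov
    have hrealK := hreal.of_containsCopy hcopy
    rcases List.mem_append.1 hK with hK | hK
    · obtain ⟨m, hm, rfl⟩ := List.mem_take_iff_getElem.1 hK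
      have hmk : m < k := lt_of_lt_of_le hm (min_le_left _ _)
      have hpow : (4 * r) ^ (m + 1) ≤ (4 * r) ^ k := Nat.pow_le_pow_right (by omega) hmk
      obtain ⟨C', hC', ctr, hctr⟩ := ih m hmk (hmk.trans hk) _ _ (by nlinarith) hrealK
      refine ⟨C', hC', ctr, fun x => ?_⟩
      obtain ⟨v, hv, hle⟩ := hctr x
      exact ⟨v, hv, hle.trans (pow_le_pow_right₀ (by norm_num) (by nlinarith))⟩
    · rw [List.mem_singleton.1 hK] at hrealK
      exact absurd hrealK
        (not_realizes_matchingHyp (by omega) hd hV (one_le_pow₀ (by norm_num)))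

theorem stmt10 (ν r ℓ : ℕ) (hr : 2 ≤ r)
    (Hs : List (PHyp r)) (hlen : Hs.length = ℓ)
    (hlast : ∃ e : Fin r → ℕ, Hs.getLast? = some {e})
    (hseq : RyserStableSeq ((r - 1) * ν) Hs [matchingHyp r (ν + 1)])
    (V : Type) [Fintype V] (d : Fin r → V → V → ℝ) (hd : ∀ i, IsMetricFun (d i))
    (hV : ∀ S : Finset V, S.card = ν + 1 → ∃ u ∈ S, ∃ v ∈ S, u ≠ v ∧ ∃ i, d i u v ≤ 1) :
    ∃ n ≤ (r - 1) * ν, ∃ (col : Fin n → Fin r) (ctr : Fin n → V),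
      ∀ x : V, ∃ j, d (col j) (ctr j) x ≤ (9 : ℝ) ^ (4 * r) ^ (ℓ + 3) := by
  classical
  rcases isEmpty_or_nonempty V with hempty | hne
  · exact ⟨0, Nat.zero_le _, Fin.elim0, Fin.elim0, fun x => hempty.elim x⟩
  obtain ⟨e, he⟩ := hlast
  have hpos : 0 < Hs.length := List.length_pos_iff.2 (by rintro rfl; simp at he)
  have hlt : ℓ - 1 < Hs.length := by omega
  have hget : Hs[ℓ - 1] = {e} := by
    rw [List.getLast?_eq_getElem?, List.getElem?_eq_some_iff] at he
    obtain ⟨_, he⟩ := he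
    simpa only [hlen] using he
  have hreal : Realizes d Hs[ℓ - 1] (9 ^ 0) (9 ^ (4 * r) ^ (ℓ + 3)) := by
    rw [hget]
    refine ⟨fun _ => Classical.arbitrary V, fun f hf g hg i => ⟨fun _ => ?_, fun h => ?_⟩⟩
    · rw [((hd i).eq_zero_iff _ _).2 rfl]
      norm_num
    · rw [Finset.mem_singleton.1 hf, Finset.mem_singleton.1 hg] at h
      exact absurd rfl h
  obtain ⟨C, hC, ctr, hctr⟩ := hseq.exists_cover hr hd hV (ℓ - 1) hlt 0 _
    (by rw [zero_add]; exact Nat.pow_le_pow_right (by omega) (by omega)) hreal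
  refine ⟨C.card, hC, fun j => (C.equivFin.symm j).1.1, fun j => ctr (C.equivFin.symm j).1,
    fun x => ?_⟩
  obtain ⟨v, hv, hle⟩ := hctr x
  exact ⟨C.equivFin ⟨v, hv⟩, by simpa using hle⟩
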